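/- arXiv:1902.00022 — 6 statements merged into one kernel-verified Lean document; each statement's English description precedes it below -/
import Mathlib

section
/- Let r ≥ 1 and let (D, D', D'') be an equitable partition of Q_{2r} with quotient matrix [[0,0,2r],[0,0,2r],[r,r,0]] such that D ∪ D' is the set of even-weight words of F_2^{2r}. Define C = {(x, y) : x ∈ D, y ∈ F_2^r, wt(y) even} ∪ {(x, y) : x ∈ D', y ∈ F_2^r, wt(y) odd} ⊆ F_2^{3r}. Then (C, C̄) is an equitable partition of Q_{3r} with quotient matrix [[0,3r],[r,2r]], and ⟨c, v⟩ = 0 for every c ∈ C, where v = 1^{2r}0^r. -/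
/-- Binary words of length `n`: the vertex set of the hypercube `Q_n`. -/
abbrev BW (n : ℕ) := Fin n → ZMod 2

/-- Adjacency in a Hamming-type graph (hypercube `Q_n`, Hamming graph `H(r,q)`, ...):
two words are adjacent iff they differ in exactly one coordinate. -/
def hAdj {ι : Type*} {β : ι → Type*} [Fintype ι] [∀ i, DecidableEq (β i)]
    (x y : ∀ i, β i) : Prop :=
  hammingDist x y = 1

/-- `(Cs i)_{i < k}` is an equitable partition of the graph with vertex set `V` and
adjacency relation `adj`, with quotient matrix `S`: the cells are nonempty, every vertex
lies in exactly one cell, and every vertex of `Cs i` has exactly `S i j` neighbors in `Cs j`. -/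
def IsEquitablePartition {V : Type*} (adj : V → V → Prop) {k : ℕ}
    (Cs : Fin k → Set V) (S : Fin k → Fin k → ℕ) : Prop :=
  (∀ i, (Cs i).Nonempty) ∧
  (∀ v : V, ∃! i, v ∈ Cs i) ∧
  ∀ i j : Fin k, ∀ v ∈ Cs i, {w | w ∈ Cs j ∧ adj v w}.ncard = S i j

open Classical in
/-- Number of coordinate flips of `v` landing in `S`. -/
noncomputable def nbc {n : ℕ} (v : BW n) (S : Set (BW n)) : ℕ :=
  ∑ i, if v + Pi.single i 1 ∈ S then 1 else 0

lemma zmod_two_cases (a : ZMod 2) : a = 0 ∨ a = 1 := by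
  revert a; decide

lemma hAdj_iff {n : ℕ} (v w : BW n) : hAdj v w ↔ ∃ i, v + Pi.single i 1 = w := by
  unfold hAdj hammingDist
  rw [Finset.card_eq_one]
  constructor
  · rintro ⟨i, hi⟩
    refine ⟨i, ?_⟩
    funext j
    have hj : v j ≠ w j ↔ j = i := by
      have := Finset.ext_iff.1 hi j
      simpa using this
    have key : ∀ a b : ZMod 2, a ≠ b → a + 1 = b := by decide
    by_cases h : j = i
    · subst h
      simpa using key _ _ (hj.2 rfl)
    · have : v j = w j := by
        by_contra h'
        exact h (hj.1 h')
      simp [h, this]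
  · rintro ⟨i, rfl⟩
    refine ⟨i, ?_⟩
    ext j
    by_cases h : j = i
    · subst h; simp
    · simp [h]

lemma single_inj {n : ℕ} (v : BW n) :
    Function.Injective (fun i : Fin n => v + Pi.single i (1 : ZMod 2)) := by
  intro i j h
  have h2 : (Pi.single i 1 : BW n) = Pi.single j 1 := add_left_cancel h
  by_contra hij
  have := congrFun h2 i
  simp [hij] at this

lemma ncard_eq_nbc {n : ℕ} (v : BW n) (S : Set (BW n)) :
    {w | w ∈ S ∧ hAdj v w}.ncard = nbc v S := by
  classical
  have : {w | w ∈ S ∧ hAdj v w} =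
      (fun i : Fin n => v + Pi.single i (1 : ZMod 2)) ''
        ((Finset.univ.filter fun i => v + Pi.single i (1 : ZMod 2) ∈ S : Finset (Fin n)) :
          Set (Fin n)) := by
    ext w
    simp only [Set.mem_ofPred_eq, hAdj_iff, Set.mem_image, Finset.coe_filter, Finset.mem_univ,
      true_and]
    constructor
    · rintro ⟨h, i, rfl⟩
      exact ⟨i, h, rfl⟩
    · rintro ⟨i, h, rfl⟩
      exact ⟨h, i, rfl⟩
  rw [this, Set.ncard_image_of_injective _ (single_inj v), Set.ncard_coe_finset,
    Finset.card_filter]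
  unfold nbc
  apply Finset.sum_congr rfl
  intro i _
  congr

lemma nbc_compl {n : ℕ} (v : BW n) (S : Set (BW n)) : nbc v Sᶜ + nbc v S = n := by
  classical
  unfold nbc
  rw [← Finset.sum_add_distrib]
  trans ∑ i : Fin n, 1
  · apply Finset.sum_congr rfl
    intro i _
    by_cases h : v + Pi.single i 1 ∈ S <;> simp [h]
  · simp

lemma nbc_append {m n : ℕ} (x : BW m) (y : BW n) (S : Set (BW (m + n))) :
    nbc (Fin.append x y) S =
      nbc x {x' | Fin.append x' y ∈ S} + nbc y {y' | Fin.append x y' ∈ S} := by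
  unfold nbc
  rw [Fin.sum_univ_add]
  have h1 : ∀ i : Fin m, Fin.append x y + Pi.single (Fin.castAdd n i) 1 =
      Fin.append (x + Pi.single i 1) y := by
    intro i
    funext k
    refine Fin.addCases (fun k => ?_) (fun k => ?_) k
    · by_cases h : k = i
      · subst h; simp
      · simp [h]
    · have : Fin.natAdd m k ≠ Fin.castAdd n i := by
        intro h
        have := congrArg Fin.val h
        have := i.2
        simp at *
        omega
      simp [Pi.single_eq_of_ne this]
  have h2 : ∀ i : Fin n, Fin.append x y + Pi.single (Fin.natAdd m i) 1 =
      Fin.append x (y + Pi.single i 1) := by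
    intro i
    funext k
    refine Fin.addCases (fun k => ?_) (fun k => ?_) k
    · have : Fin.castAdd n k ≠ Fin.natAdd m i := by
        intro h
        have := congrArg Fin.val h
        have := k.2
        simp at *
        omega
      simp [Pi.single_eq_of_ne this]
    · by_cases h : k = i
      · subst h; simp
      · simp [h]
  congr 1
  · apply Finset.sum_congr rfl
    intro i _
    have := h1 i
    refine @if_congr _ _ _ (_) (_) _ _ _ _ ?_ rfl rfl
    rw [Set.mem_ofPred_eq, ← this]
  · apply Finset.sum_congr rfl
    intro i _
    have := h2 i
    refine @if_congr _ _ _ (_) (_) _ _ _ _ ?_ rfl rfl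
    rw [Set.mem_ofPred_eq, ← this]

lemma nbc_empty {n : ℕ} (v : BW n) : nbc v ∅ = 0 := by simp [nbc]

lemma norm_cast_sum {n : ℕ} (x : BW n) : ((hammingNorm x : ℕ) : ZMod 2) = ∑ i, x i := by
  unfold hammingNorm
  rw [Finset.card_filter]
  push_cast
  apply Finset.sum_congr rfl
  intro i _
  rcases zmod_two_cases (x i) with h | h <;> simp [h]

lemma even_iff_sum {n : ℕ} (x : BW n) : Even (hammingNorm x) ↔ ∑ i, x i = 0 := by
  rw [← norm_cast_sum, ZMod.natCast_eq_zero_iff_even]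

lemma even_flip {n : ℕ} (x : BW n) (i : Fin n) :
    Even (hammingNorm (x + Pi.single i 1)) ↔ ¬ Even (hammingNorm x) := by
  rw [even_iff_sum, even_iff_sum]
  simp only [Pi.add_apply, Finset.sum_add_distrib, Finset.sum_pi_single', Finset.mem_univ, if_true,
    Finset.sum_pi_single]
  generalize ∑ i, x i = a
  revert a; decide

lemma nbc_of_all {n : ℕ} (v : BW n) (S : Set (BW n)) (h : ∀ i, v + Pi.single i 1 ∈ S) :
    nbc v S = n := by simp [nbc, h]

lemma nbc_of_none {n : ℕ} (v : BW n) (S : Set (BW n)) (h : ∀ i, v + Pi.single i 1 ∉ S) :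
    nbc v S = 0 := by simp [nbc, h]

theorem stmt_9 (r : ℕ) (hr : 1 ≤ r) (D D' D'' : Set (BW (2*r)))
    (hDD : IsEquitablePartition hAdj ![D, D', D'']
      ![![0, 0, 2*r], ![0, 0, 2*r], ![r, r, 0]])
    (hev : D ∪ D' = {x | Even (hammingNorm x)})
    (C : Set (BW (2*r + r)))
    (hC : C = {z | ∃ (x : BW (2*r)) (y : BW r),
      ((x ∈ D ∧ Even (hammingNorm y)) ∨ (x ∈ D' ∧ Odd (hammingNorm y))) ∧
      z = Fin.append x y}) :
    IsEquitablePartition hAdj ![C, Cᶜ] ![![0, 3*r], ![r, 2*r]] ∧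
    ∀ c ∈ C, ∑ i, c i * (Fin.append (fun _ => (1 : ZMod 2)) (0 : BW r)) i = 0 := by
  obtain ⟨hne, hpart, hcnt⟩ := hDD
  simp only [ncard_eq_nbc] at hcnt
  have memC : ∀ x y, Fin.append x y ∈ C ↔
      ((x ∈ D ∧ Even (hammingNorm y)) ∨ (x ∈ D' ∧ Odd (hammingNorm y))) := by
    intro x y
    rw [hC]
    constructor
    · rintro ⟨x', y', h, he⟩
      have h1 : x = x' := by
        funext i
        simpa using congrFun he (Fin.castAdd r i)
      have h2 : y = y' := by
        funext i
        simpa using congrFun he (Fin.natAdd (2*r) i)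
      rw [h1, h2]; exact h
    · intro h
      exact ⟨x, y, h, rfl⟩
  have split : ∀ z : BW (2*r + r), ∃ x y, z = Fin.append x y := fun z =>
    ⟨fun i => z (Fin.castAdd r i), fun i => z (Fin.natAdd (2*r) i),
      (Fin.append_castAdd_natAdd).symm⟩
  have cov : ∀ x, x ∈ D ∨ x ∈ D' ∨ x ∈ D'' := by
    intro x
    obtain ⟨i, hi, -⟩ := hpart x
    fin_cases i
    · exact Or.inl hi
    · exact Or.inr (Or.inl hi)
    · exact Or.inr (Or.inr hi)
  have d01 : ∀ x, x ∈ D → x ∉ D' := by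
    intro x h h'
    have := (hpart x).unique (y₁ := 0) (y₂ := 1) h h'
    simp at this
  have d02 : ∀ x, x ∈ D → x ∉ D'' := by
    intro x h h'
    have := (hpart x).unique (y₁ := 0) (y₂ := 2) h h'
    simp at this
  have d12 : ∀ x, x ∈ D' → x ∉ D'' := by
    intro x h h'
    have := (hpart x).unique (y₁ := 1) (y₂ := 2) h h'
    simp at this
  have c00 : ∀ x ∈ D, nbc x D = 0 := hcnt 0 0
  have c01 : ∀ x ∈ D, nbc x D' = 0 := hcnt 0 1
  have c10 : ∀ x ∈ D', nbc x D = 0 := hcnt 1 0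
  have c11 : ∀ x ∈ D', nbc x D' = 0 := hcnt 1 1
  have c20 : ∀ x ∈ D'', nbc x D = r := hcnt 2 0
  have c21 : ∀ x ∈ D'', nbc x D' = r := hcnt 2 1
  have slE : ∀ y : BW r, Even (hammingNorm y) → {x' | Fin.append x' y ∈ C} = D := by
    intro y hy
    ext x
    simp [memC, hy, ← Nat.not_even_iff_odd]
  have slO : ∀ y : BW r, ¬ Even (hammingNorm y) → {x' | Fin.append x' y ∈ C} = D' := by
    intro y hy
    ext x
    simp [memC, hy, ← Nat.not_even_iff_odd]
  have cin : ∀ z ∈ C, nbc z C = 0 := by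
    intro z hz
    obtain ⟨x, y, rfl⟩ := split z
    rw [nbc_append]
    have hz' := (memC x y).1 hz
    have h2 : nbc y {y' | Fin.append x y' ∈ C} = 0 := by
      apply nbc_of_none
      intro i
      simp only [Set.mem_ofPred_eq, memC, ← Nat.not_even_iff_odd, even_flip] at hz' ⊢
      have := d01 x
      tauto
    rw [h2]
    rcases hz' with ⟨hx, hy⟩ | ⟨hx, hy⟩
    · rw [slE y hy, c00 x hx]
    · rw [slO y (Nat.not_even_iff_odd.2 hy), c11 x hx]
  have cout : ∀ z ∉ C, nbc z C = r := by
    intro z hz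
    obtain ⟨x, y, rfl⟩ := split z
    rw [nbc_append]
    have hz' := hz
    rw [memC] at hz'
    have a1 := d01 x
    have a2 := d02 x
    have a3 := d12 x
    by_cases h2 : x ∈ D''
    · rw [nbc_of_none y]
      · by_cases hy : Even (hammingNorm y)
        · rw [slE y hy, c20 x h2]; rfl
        · rw [slO y hy, c21 x h2]; rfl
      · intro i
        simp only [Set.mem_ofPred_eq, memC]
        tauto
    · rw [nbc_of_all y]
      · have : nbc x {x' | Fin.append x' y ∈ C} = 0 := by
          by_cases hy : Even (hammingNorm y)
          · rw [slE y hy]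
            rcases cov x with h | h | h
            · exact c00 x h
            · exact c10 x h
            · exact absurd h h2
          · rw [slO y hy]
            rcases cov x with h | h | h
            · exact c01 x h
            · exact c11 x h
            · exact absurd h h2
        rw [this, zero_add]
      · intro i
        have := cov x
        simp only [Set.mem_ofPred_eq, memC, ← Nat.not_even_iff_odd, even_flip] at hz' ⊢
        tauto
  refine ⟨⟨?_, ?_, ?_⟩, ?_⟩
  · intro i
    fin_cases i
    · obtain ⟨x, hx⟩ := hne 0
      exact ⟨Fin.append x 0, (memC x 0).2 (Or.inl ⟨hx, by simp⟩)⟩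
    · obtain ⟨x, hx⟩ := hne 2
      refine ⟨Fin.append x 0, fun h => ?_⟩
      have hx' : x ∈ D'' := hx
      rcases (memC x 0).1 h with ⟨h, -⟩ | ⟨h, -⟩
      · exact d02 x h hx'
      · exact d12 x h hx'
  · intro v
    by_cases hv : v ∈ C
    · refine ⟨0, hv, ?_⟩
      intro j hj
      fin_cases j
      · rfl
      · exact absurd hv hj
    · refine ⟨1, hv, ?_⟩
      intro j hj
      fin_cases j
      · exact absurd hj hv
      · rfl
  · intro i j v hv
    rw [ncard_eq_nbc]
    have hc := nbc_compl v C
    fin_cases i <;> fin_cases j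
    · exact cin v hv
    · have := cin v hv
      change nbc v Cᶜ = 3 * r
      omega
    · exact cout v hv
    · have := cout v hv
      change nbc v Cᶜ = 2 * r
      omega
  · intro c hc
    obtain ⟨x, y, rfl⟩ := split c
    have hx : x ∈ D ∪ D' := by
      rcases (memC x y).1 hc with ⟨h, -⟩ | ⟨h, -⟩
      · exact Or.inl h
      · exact Or.inr h
    rw [hev] at hx
    rw [Fin.sum_univ_add]
    simpa using (even_iff_sum x).1 hx
end

section
/- Let n = 3r and let f : F_2^n → F_2^2 be a (2n/3 − 1)-resilient (n,2)-function, with graph G(f) = {(x, f(x)) : x ∈ F_2^n} ⊆ F_2^{n+2}. For i ∈ {0,1,2,3} let c_i ∈ F_2^3 be the 3-bit binary representation of i, T_i = {c_i, c_i + 111}, and let C = ∪_{i=0}^{3} f^{-1}(i) × T_i ⊆ F_2^{n+3} be the corresponding cell of the associated equitable 2-partition of Q_{n+3} (here i ∈ {0,1,2,3} is identified with its 2-bit representation as a value of f). Then the affine rank of C equals the affine rank of G(f) plus 1. -/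
/-- `f` is correlation immune of order `t`: for every subcube obtained by fixing the
coordinates in a set `K` with `|K| ≤ t` (i.e. an `l`-subcube with `l = n - |K| ≥ n - t`)
and every value `y`, `|f⁻¹(y) ∩ Q'| = |f⁻¹(y)| / 2^{|K|}`. -/
def CorrImmune {n m : ℕ} (f : BW n → BW m) (t : ℕ) : Prop :=
  ∀ K : Finset (Fin n), K.card ≤ t → ∀ a : BW n, ∀ y : BW m,
    2 ^ K.card * {x | f x = y ∧ ∀ i ∈ K, x i = a i}.ncard = {x | f x = y}.ncard

/-- `f` is a `t`-resilient `(n,m)`-function: balanced and correlation immune of order `t`. -/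
def Resilient {n m : ℕ} (f : BW n → BW m) (t : ℕ) : Prop :=
  (∀ y : BW m, {x | f x = y}.ncard = 2 ^ (n - m)) ∧ CorrImmune f t

/-- The 2-bit binary representation of `i ∈ {0,1,2,3}`. -/
def bits2 : Fin 4 → BW 2 := ![![0,0], ![0,1], ![1,0], ![1,1]]

/-- The 3-bit binary representation of `i ∈ {0,1,2,3}`. -/
def bits3 : Fin 4 → BW 3 := ![![0,0,0], ![0,0,1], ![0,1,0], ![0,1,1]]

/-- `T_i = {c_i, c_i + 111} ⊆ F_2^3`. -/
def Tpair (i : Fin 4) : Set (BW 3) := {bits3 i, bits3 i + ![1,1,1]}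

/-- The affine rank of a subset of `F_2^N`: the dimension of its affine span. -/
noncomputable def affRank {N : ℕ} (s : Set (BW N)) : ℕ :=
  Module.finrank (ZMod 2) (affineSpan (ZMod 2) s).direction

/-- The graph `G(f) = {(x, f(x))} ⊆ F_2^{n+m}` of an `(n,m)`-function. -/
def graphOf {n m : ℕ} (f : BW n → BW m) : Set (BW (n + m)) :=
  {z | ∃ x : BW n, z = Fin.append x (f x)}

/-- The linear embedding `(x, y) ↦ (x, 0, y)`. -/
def phiEmb (n : ℕ) : BW (n + 2) →ₗ[ZMod 2] BW (n + 3) where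
  toFun z := Fin.append (fun i : Fin n => z (Fin.castAdd 2 i))
    ![0, z (Fin.natAdd n 0), z (Fin.natAdd n 1)]
  map_add' a b := by
    funext i
    refine Fin.addCases (fun i => ?_) (fun i => ?_) i
    · simp
    · fin_cases i <;> simp [Fin.append_right]
  map_smul' c a := by
    funext i
    refine Fin.addCases (fun i => ?_) (fun i => ?_) i
    · simp
    · fin_cases i <;> simp [Fin.append_right]

theorem phiEmb_append {n : ℕ} (x : BW n) (y : BW 2) :
    phiEmb n (Fin.append x y) = Fin.append x ![0, y 0, y 1] := by
  simp [phiEmb]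

theorem phiEmb_inj (n : ℕ) : Function.Injective (phiEmb n) := by
  intro a b h
  funext i
  refine Fin.addCases (fun i => ?_) (fun i => ?_) i
  · simpa [phiEmb] using congrFun h (Fin.castAdd 3 i)
  · fin_cases i
    · simpa [phiEmb, Fin.append_right] using congrFun h (Fin.natAdd n (1 : Fin 3))
    · simpa [phiEmb, Fin.append_right] using congrFun h (Fin.natAdd n (2 : Fin 3))

/-- The vector `(0, 111)`. -/
def wVec (n : ℕ) : BW (n + 3) := Fin.append 0 ![1, 1, 1]

theorem append_add {n : ℕ} (x : BW n) (t : BW 3) :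
    Fin.append x (t + ![1, 1, 1]) = Fin.append x t + wVec n := by
  funext i
  refine Fin.addCases (fun i => ?_) (fun i => ?_) i
  · simp [wVec]
  · simp only [wVec, Fin.append_right, Pi.add_apply]

theorem bits3_eq (i : Fin 4) : bits3 i = ![0, bits2 i 0, bits2 i 1] := by
  fin_cases i <;> simp [bits2, bits3]

theorem bits2_surj (y : BW 2) : ∃ i, y = bits2 i := by
  revert y; unfold bits2; decide

theorem wVec_not_mem (n : ℕ) (S : Submodule (ZMod 2) (BW (n + 2))) :
    wVec n ∉ S.map (phiEmb n) := by
  rintro ⟨a, -, h⟩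
  have := congrFun h (Fin.natAdd n (0 : Fin 3))
  simp [phiEmb, wVec, Fin.append_right] at this

theorem stmt_12 (n r : ℕ) (hn : n = 3 * r)
    (f : BW n → BW 2) (hf : Resilient f (2 * r - 1))
    (C : Set (BW (n + 3)))
    (hC : C = {z | ∃ i : Fin 4, ∃ x : BW n, f x = bits2 i ∧ ∃ t ∈ Tpair i, z = Fin.append x t}) :
    affRank C = affRank (graphOf f) + 1 := by
  have hmem : ∀ z, z ∈ C ↔ ∃ g ∈ graphOf f, z = phiEmb n g ∨ z = phiEmb n g + wVec n := by
    intro z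
    subst hC
    constructor
    · rintro ⟨i, x, hx, t, ht, rfl⟩
      refine ⟨_, ⟨x, rfl⟩, ?_⟩
      rw [phiEmb_append, hx, ← bits3_eq, ← append_add]
      rcases ht with rfl | rfl
      · exact Or.inl rfl
      · exact Or.inr rfl
    · rintro ⟨_, ⟨x, rfl⟩, h⟩
      obtain ⟨i, hi⟩ := bits2_surj (f x)
      rw [phiEmb_append, hi, ← bits3_eq, ← append_add] at h
      rcases h with rfl | rfl
      · exact ⟨i, x, hi, _, Or.inl rfl, rfl⟩
      · exact ⟨i, x, hi, _, Or.inr rfl, rfl⟩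
  have hspan : vectorSpan (ZMod 2) C =
      (vectorSpan (ZMod 2) (graphOf f)).map (phiEmb n) ⊔ Submodule.span (ZMod 2) {wVec n} := by
    apply le_antisymm
    · rw [vectorSpan_def, Submodule.span_le]
      rintro _ ⟨a, ha, b, hb, rfl⟩
      obtain ⟨g, hg, ha⟩ := (hmem a).1 ha
      obtain ⟨g', hg', hb⟩ := (hmem b).1 hb
      have h1 : phiEmb n g - phiEmb n g' ∈
          (vectorSpan (ZMod 2) (graphOf f)).map (phiEmb n) ⊔
            Submodule.span (ZMod 2) {wVec n} := by
        apply Submodule.mem_sup_left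
        rw [← map_sub]
        exact Submodule.mem_map_of_mem (vsub_mem_vectorSpan _ hg hg')
      have h2 : wVec n ∈ (vectorSpan (ZMod 2) (graphOf f)).map (phiEmb n) ⊔
            Submodule.span (ZMod 2) {wVec n} :=
        Submodule.mem_sup_right (Submodule.mem_span_singleton_self _)
      simp only [vsub_eq_sub, SetLike.mem_coe]
      rcases ha with rfl | rfl <;> rcases hb with rfl | rfl
      · exact h1
      · convert Submodule.sub_mem _ h1 h2 using 1; abel
      · convert Submodule.add_mem _ h1 h2 using 1; abel
      · convert h1 using 1; abel
    · apply sup_le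
      · rw [vectorSpan_def, Submodule.map_span, Submodule.span_le]
        rintro _ ⟨_, ⟨a, ha, b, hb, rfl⟩, rfl⟩
        simp only [vsub_eq_sub, map_sub]
        exact vsub_mem_vectorSpan _ ((hmem _).2 ⟨a, ha, Or.inl rfl⟩)
          ((hmem _).2 ⟨b, hb, Or.inl rfl⟩)
      · rw [Submodule.span_le, Set.singleton_subset_iff]
        have hg : Fin.append (0 : BW n) (f 0) ∈ graphOf f := ⟨0, rfl⟩
        have := vsub_mem_vectorSpan (ZMod 2) ((hmem _).2 ⟨_, hg, Or.inr rfl⟩)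
          ((hmem _).2 ⟨_, hg, Or.inl rfl⟩)
        simpa using this
  have hw := wVec_not_mem n (vectorSpan (ZMod 2) (graphOf f))
  have hw0 : wVec n ≠ 0 := fun h => hw (h ▸ Submodule.zero_mem _)
  have hinf : (vectorSpan (ZMod 2) (graphOf f)).map (phiEmb n) ⊓
      Submodule.span (ZMod 2) {wVec n} = ⊥ := by
    rw [← disjoint_iff]
    exact (Submodule.disjoint_span_singleton' hw0).2 hw
  have hfin := Submodule.finrank_sup_add_finrank_inf_eq
    ((vectorSpan (ZMod 2) (graphOf f)).map (phiEmb n)) (Submodule.span (ZMod 2) {wVec n})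
  rw [hinf, finrank_bot, finrank_span_singleton hw0,
    (Submodule.equivMapOfInjective (phiEmb n) (phiEmb_inj n) _).finrank_eq.symm] at hfin
  unfold affRank
  rw [direction_affineSpan, direction_affineSpan, hspan]
  simpa using hfin
end

section
/- Let (C_i)_{i=0}^{k} be an equitable partition of the Hamming graph H(r,4) with quotient matrix S. Set T_0 = {000, 111}, T_1 = {010, 101}, T_2 = {100, 011}, T_3 = {110, 001} ⊆ F_2^3, and for each i define C'_i = ∪_{(v_1,...,v_r) ∈ C_i} T_{v_1} × ... × T_{v_r} ⊆ F_2^{3r}. Then (C'_i)_{i=0}^{k} is an equitable partition of the hypercube Q_{3r} with the same quotient matrix S. -/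
/-- The coordinate of `F_2^N` corresponding to position `b` in the `j`-th block,
where the blocks have lengths `n 0, ..., n (r-1)` with `∑ j, n j = N`. -/
def blockCoord {N r : ℕ} {n : Fin r → ℕ} (hN : ∑ j, n j = N)
    (j : Fin r) (b : Fin (n j)) : Fin N :=
  ⟨(∑ i ∈ Finset.univ.filter (fun i => i < j), n i) + b, by
    have hb := b.isLt
    have hnotin : j ∉ Finset.univ.filter (fun i => i < j) := by simp
    have h1 : (∑ i ∈ insert j (Finset.univ.filter (fun i => i < j)), n i) ≤ ∑ i, n i :=
      Finset.sum_le_sum_of_subset (Finset.subset_univ _)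
    rw [Finset.sum_insert hnotin] at h1
    omega⟩

/-- The concatenation `∪_{(v_1,...,v_r) ∈ D} T^{(1)}_{v_1} × ... × T^{(r)}_{v_r} ⊆ F_2^N`,
where the `j`-th block of coordinates has length `n j` and `∑ j, n j = N`. -/
def concatProd {N r : ℕ} {n : Fin r → ℕ} (hN : ∑ j, n j = N)
    (T : ∀ j : Fin r, Fin 4 → Set (Fin (n j) → ZMod 2))
    (D : Set (Fin r → Fin 4)) : Set (BW N) :=
  {x | ∃ v ∈ D, ∀ j : Fin r, (fun b : Fin (n j) => x (blockCoord hN j b)) ∈ T j (v j)}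

/-- The six pairs `T_0 = {000,111}`, `T_1 = {010,101}`, `T_2 = {100,011}`, `T_3 = {110,001}`. -/
def Tcov : Fin 4 → Set (BW 3) :=
  ![{![0,0,0], ![1,1,1]}, {![0,1,0], ![1,0,1]}, {![1,0,0], ![0,1,1]}, {![1,1,0], ![0,0,1]}]

lemma hAdj_iff_s14 {ι : Type*} {β : ι → Type*} [Fintype ι] [∀ i, DecidableEq (β i)]
    (x y : ∀ i, β i) : hAdj x y ↔ ∃ i, x i ≠ y i ∧ ∀ i', i' ≠ i → x i' = y i' := by
  unfold hAdj hammingDist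
  rw [Finset.card_eq_one]
  constructor
  · rintro ⟨a, ha⟩
    have h : ∀ i, x i ≠ y i ↔ i = a := fun i => by
      have := Finset.ext_iff.1 ha i
      simpa using this
    refine ⟨a, (h a).2 rfl, fun i' hi' => ?_⟩
    by_contra hne
    exact hi' ((h i').1 hne)
  · rintro ⟨a, ha, h⟩
    refine ⟨a, ?_⟩
    ext i
    simp only [Finset.mem_filter, Finset.mem_univ, true_and, Finset.mem_singleton]
    constructor
    · intro hne
      by_contra hi
      exact hne (h i hi)
    · rintro rfl
      exact ha

/-- The index of the pair containing a given word of length three. -/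
def gcov (p : BW 3) : Fin 4 :=
  if p 0 = p 1 then (if p 1 = p 2 then 0 else 3) else if p 0 = p 2 then 1 else 2

lemma mem_Tcov (p : BW 3) (c : Fin 4) : p ∈ Tcov c ↔ c = gcov p := by
  have h0 : p ∈ Tcov 0 ↔ p = ![0,0,0] ∨ p = ![1,1,1] := Iff.rfl
  have h1 : p ∈ Tcov 1 ↔ p = ![0,1,0] ∨ p = ![1,0,1] := Iff.rfl
  have h2 : p ∈ Tcov 2 ↔ p = ![1,0,0] ∨ p = ![0,1,1] := Iff.rfl
  have h3 : p ∈ Tcov 3 ↔ p = ![1,1,0] ∨ p = ![0,0,1] := Iff.rfl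
  fin_cases c
  · refine h0.trans ?_
    clear h0 h1 h2 h3; revert p; decide
  · refine h1.trans ?_
    clear h0 h1 h2 h3; revert p; decide
  · refine h2.trans ?_
    clear h0 h1 h2 h3; revert p; decide
  · refine h3.trans ?_
    clear h0 h1 h2 h3; revert p; decide

lemma gcov_ne : ∀ p q : BW 3, hammingDist p q = 1 → gcov p ≠ gcov q := by decide

lemma gcov_inj (p q q' : BW 3) (h : hammingDist p q = 1) (h' : hammingDist p q' = 1)
    (e : gcov q = gcov q') : q = q' := by
  revert p q q'
  set_option maxRecDepth 100000 in decide

lemma gcov_surj : ∀ (p : BW 3) (c : Fin 4), gcov p ≠ c →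
    ∃ q : BW 3, hammingDist p q = 1 ∧ c = gcov q := by decide

lemma blockCoord_val {r : ℕ} (hN : (∑ _j : Fin r, 3) = 3 * r) (j : Fin r) (b : Fin 3) :
    (blockCoord (n := fun _ => 3) hN j b : ℕ) = 3 * j + b := by
  have : (Finset.univ.filter (fun i => i < j)) = Finset.Iio j := by ext; simp
  simp [blockCoord, this, mul_comm]

lemma blockCoord_bij {r : ℕ} (hN : (∑ _j : Fin r, 3) = 3 * r) :
    Function.Bijective
      (fun q : Fin r × Fin 3 => blockCoord (n := fun _ => 3) hN q.1 q.2) := by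
  constructor
  · rintro ⟨j, b⟩ ⟨j', b'⟩ h
    have h2 := congrArg Fin.val h
    simp only [blockCoord_val] at h2
    have hj : j = j' := by ext; omega
    have hb : b = b' := by ext; omega
    rw [hj, hb]
  · intro i
    refine ⟨(⟨i / 3, by omega⟩, ⟨i % 3, by omega⟩), ?_⟩
    ext
    simp only [blockCoord_val]
    omega

/-- Splitting a word of length `3 * r` into blocks. -/
noncomputable def splitE {r : ℕ} (hN : (∑ _j : Fin r, 3) = 3 * r) :
    BW (3 * r) ≃ (Fin r → BW 3) :=
  (Equiv.arrowCongr (Equiv.ofBijective _ (blockCoord_bij hN)).symm (Equiv.refl _)).trans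
    (Equiv.curry _ _ _)

lemma splitE_apply {r : ℕ} (hN : (∑ _j : Fin r, 3) = 3 * r) (x : BW (3 * r)) (j : Fin r)
    (b : Fin 3) : splitE hN x j b = x (blockCoord (n := fun _ => 3) hN j b) := rfl

lemma adj_split {r : ℕ} (hN : (∑ _j : Fin r, 3) = 3 * r) (x y : BW (3 * r)) :
    hAdj x y ↔ ∃ j, hammingDist (splitE hN x j) (splitE hN y j) = 1 ∧
      ∀ j', j' ≠ j → splitE hN x j' = splitE hN y j' := by
  rw [hAdj_iff_s14]
  constructor
  · rintro ⟨i, hi, h⟩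
    obtain ⟨⟨j, b⟩, rfl⟩ := (blockCoord_bij hN).2 i
    refine ⟨j, (hAdj_iff_s14 _ _).2 ⟨b, hi, fun b' hb' => h _ fun e => hb' ?_⟩,
      fun j' hj' => funext fun b' => h _ fun e => hj' ?_⟩
    · exact congrArg Prod.snd ((blockCoord_bij hN).1 (a₁ := (j, b')) (a₂ := (j, b)) e)
    · exact congrArg Prod.fst ((blockCoord_bij hN).1 (a₁ := (j', b')) (a₂ := (j, b)) e)
  · rintro ⟨j, hj, h⟩
    obtain ⟨b, hb, h2⟩ := (hAdj_iff_s14 _ _).1 hj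
    refine ⟨blockCoord (n := fun _ => 3) hN j b, hb, fun i' hi' => ?_⟩
    obtain ⟨⟨j', b'⟩, rfl⟩ := (blockCoord_bij hN).2 i'
    by_cases hjj : j' = j
    · subst hjj
      exact h2 b' (fun e => hi' (by rw [e]))
    · exact congrFun (h j' hjj) b'

/-- The covering map from the hypercube to the Hamming graph. -/
noncomputable def fcov {r : ℕ} (hN : (∑ _j : Fin r, 3) = 3 * r) (x : BW (3 * r)) :
    Fin r → Fin 4 := fun j => gcov (splitE hN x j)

lemma mem_concat {r : ℕ} (hN : (∑ _j : Fin r, 3) = 3 * r) (D : Set (Fin r → Fin 4))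
    (x : BW (3 * r)) :
    x ∈ concatProd (n := fun _ => 3) hN (fun _ => Tcov) D ↔ fcov hN x ∈ D := by
  constructor
  · rintro ⟨v, hv, h⟩
    have : v = fcov hN x := funext fun j => (mem_Tcov _ _).1 (h j)
    rwa [← this]
  · intro h
    exact ⟨_, h, fun j => (mem_Tcov _ _).2 rfl⟩

lemma fcov_surj {r : ℕ} (hN : (∑ _j : Fin r, 3) = 3 * r) (u : Fin r → Fin 4) :
    ∃ x, fcov hN x = u := by
  have hg : ∀ c : Fin 4, ∃ p : BW 3, gcov p = c := by decide
  choose s hs using hg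
  refine ⟨(splitE hN).symm (fun j => s (u j)), funext fun j => ?_⟩
  simp [fcov, hs]

lemma fcov_bijOn {r : ℕ} (hN : (∑ _j : Fin r, 3) = 3 * r) (D : Set (Fin r → Fin 4))
    (x : BW (3 * r)) :
    Set.BijOn (fcov hN) {w | fcov hN w ∈ D ∧ hAdj x w} {u | u ∈ D ∧ hAdj (fcov hN x) u} := by
  refine ⟨?_, ?_, ?_⟩
  · rintro w ⟨hw, ha⟩
    obtain ⟨j, hj, h⟩ := (adj_split hN _ _).1 ha
    exact ⟨hw, (hAdj_iff_s14 _ _).2 ⟨j, gcov_ne _ _ hj, fun j' hj' => congrArg gcov (h j' hj')⟩⟩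
  · rintro w ⟨-, ha⟩ w' ⟨-, ha'⟩ e
    obtain ⟨j, hj, h⟩ := (adj_split hN _ _).1 ha
    obtain ⟨j', hj', h'⟩ := (adj_split hN _ _).1 ha'
    have hjj : j = j' := by
      by_contra hne
      have e1 : gcov (splitE hN w j) = gcov (splitE hN w' j) := congrFun e j
      rw [← h' j hne] at e1
      exact gcov_ne _ _ hj e1.symm
    subst hjj
    apply (splitE hN).injective
    funext i
    by_cases hi : i = j
    · subst hi
      exact gcov_inj _ _ _ hj hj' (congrFun e i)
    · rw [← h i hi, ← h' i hi]
  · rintro u ⟨hu, ha⟩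
    obtain ⟨j, hj, h⟩ := (hAdj_iff_s14 _ _).1 ha
    obtain ⟨q, hq, hqc⟩ := gcov_surj _ _ hj
    have hf : fcov hN ((splitE hN).symm (Function.update (splitE hN x) j q)) = u := by
      funext i
      by_cases hi : i = j
      · subst hi
        simp [fcov, hqc]
      · have := h i hi
        simpa [fcov, hi] using this
    refine ⟨_, ⟨by rw [hf]; exact hu, (adj_split hN _ _).2 ⟨j, ?_, fun j' hj' => ?_⟩⟩, hf⟩
    · simpa using hq
    · simp [hj']

theorem stmt_14 (r k : ℕ) (Cs : Fin (k + 1) → Set (Fin r → Fin 4))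
    (S : Fin (k + 1) → Fin (k + 1) → ℕ)
    (hCs : IsEquitablePartition hAdj Cs S) :
    IsEquitablePartition hAdj
      (fun i => concatProd (show (∑ _j : Fin r, 3) = 3 * r by
          simp [Finset.sum_const, mul_comm]) (fun _ => Tcov) (Cs i)) S := by
  have hN : (∑ _j : Fin r, 3) = 3 * r := by simp [Finset.sum_const, mul_comm]
  obtain ⟨h1, h2, h3⟩ := hCs
  refine ⟨fun i => ?_, fun x => ?_, fun i j x hx => ?_⟩
  · obtain ⟨u, hu⟩ := h1 i
    obtain ⟨x, rfl⟩ := fcov_surj hN u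
    exact ⟨x, (mem_concat hN _ _).2 hu⟩
  · obtain ⟨i, hi, hu⟩ := h2 (fcov hN x)
    exact ⟨i, (mem_concat hN _ _).2 hi, fun i' hi' => hu i' ((mem_concat hN _ _).1 hi')⟩
  · rw [← h3 i j _ ((mem_concat hN _ _).1 hx)]
    have hb := fcov_bijOn hN (Cs j) x
    rw [← hb.image_eq, Set.ncard_image_of_injOn hb.injOn]
    congr 1
    ext w
    exact and_congr (mem_concat hN _ _) Iff.rfl
end

section
/- Let r ≥ 1 and let n_1, ..., n_r be positive multiples of 3 with N = n_1 + ... + n_r. For each j ∈ {1,...,r}, let (T^{(j)}_0, T^{(j)}_1, T^{(j)}_2, T^{(j)}_3) be an equitable partition of Q_{n_j} with quotient matrix having 0 on the diagonal and n_j/3 in every off-diagonal entry. Let (C_0, C_1, C_2, C_3) be a Latin r-cube of order 4, and define C'_i = ∪_{(v_1,...,v_r) ∈ C_i} T^{(1)}_{v_1} × ... × T^{(r)}_{v_r} ⊆ F_2^N for i = 0,1,2,3. Then (C'_0, C'_1, C'_2, C'_3) is an equitable partition of Q_N with quotient matrix having 0 on the diagonal and N/3 in every off-diagonal entry. -/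
/-- A Latin `r`-cube of order 4: an equitable partition of the Hamming graph `H(r,4)`
into four cells, with quotient matrix having `0` on the diagonal and `r` off the diagonal. -/
def IsLatinCube (r : ℕ) (Cs : Fin 4 → Set (Fin r → Fin 4)) : Prop :=
  IsEquitablePartition hAdj Cs (fun i j => if i = j then 0 else r)

/-- A (4-ary distance-2) MDS code in `H(r,4)`: `(C, C̄)` is an equitable partition
of `H(r,4)` with quotient matrix `[[0, 3r], [r, 2r]]`. -/
def IsMDS (r : ℕ) (C : Set (Fin r → Fin 4)) : Prop :=
  IsEquitablePartition hAdj ![C, Cᶜ] ![![0, 3*r], ![r, 2*r]]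

/-- The word `x` with its `k`-th bit flipped. -/
def flipBit {n : ℕ} (x : Fin n → ZMod 2) (k : Fin n) : Fin n → ZMod 2 :=
  Function.update x k (x k + 1)

theorem hAdj_iff_differ_once {ι : Type*} {β : Type*} [Fintype ι] [DecidableEq ι] [DecidableEq β]
    (x w : ι → β) :
    hAdj x w ↔ ∃ k, x k ≠ w k ∧ ∀ i, i ≠ k → x i = w i := by
  unfold hAdj hammingDist
  rw [Finset.card_eq_one]
  constructor
  · rintro ⟨k, hk⟩
    have h : ∀ i, x i ≠ w i ↔ i = k := by
      intro i
      have := congrArg (fun s => i ∈ s) hk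
      simpa using this
    refine ⟨k, (h k).2 rfl, fun i hi => ?_⟩
    by_contra hne
    exact hi ((h i).1 hne)
  · rintro ⟨k, hk, h⟩
    refine ⟨k, ?_⟩
    ext i
    simp only [Finset.mem_filter, Finset.mem_univ, true_and, Finset.mem_singleton]
    constructor
    · intro hne
      by_contra hi
      exact hne (h i hi)
    · rintro rfl
      exact hk

theorem zmod_two_ne_iff (a b : ZMod 2) : a ≠ b ↔ b = a + 1 := by
  revert a b; decide

theorem hAdj_iff_flipBit {n : ℕ} (x w : Fin n → ZMod 2) :
    hAdj x w ↔ ∃ k, flipBit x k = w := by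
  rw [hAdj_iff_differ_once]
  refine exists_congr fun k => ?_
  constructor
  · rintro ⟨hk, h⟩
    ext i
    by_cases hi : i = k
    · subst hi
      simp [flipBit, (zmod_two_ne_iff _ _).1 hk]
    · simp [flipBit, hi, h i hi]
  · rintro rfl
    refine ⟨(zmod_two_ne_iff _ _).2 (by simp [flipBit]), fun i hi => by simp [flipBit, hi]⟩

theorem flipBit_injective {n : ℕ} (x : Fin n → ZMod 2) : Function.Injective (flipBit x) := by
  intro k l h
  by_contra hne
  have := congrFun h k
  simp [flipBit, hne] at this

open Classical in
theorem ncard_neighbors {n : ℕ} (x : Fin n → ZMod 2) (S : Set (Fin n → ZMod 2)) :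
    {w | w ∈ S ∧ hAdj x w}.ncard = (Finset.univ.filter (fun k => flipBit x k ∈ S)).card := by
  rw [← Set.ncard_coe_finset, ← Set.ncard_image_of_injective _ (flipBit_injective x)]
  congr 1
  ext w
  simp only [Set.mem_ofPred_eq, hAdj_iff_flipBit, Set.mem_image, Finset.coe_filter,
    Finset.mem_univ, true_and]
  constructor
  · rintro ⟨hw, k, rfl⟩
    exact ⟨k, hw, rfl⟩
  · rintro ⟨k, hk, rfl⟩
    exact ⟨hk, k, rfl⟩

theorem blockCoord_ne_of_lt {N r : ℕ} {n : Fin r → ℕ} (hN : ∑ j, n j = N)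
    {j j' : Fin r} (hlt : j < j') (b : Fin (n j)) (b' : Fin (n j')) :
    blockCoord hN j b ≠ blockCoord hN j' b' := by
  intro h
  have hv := congrArg Fin.val h
  simp only [blockCoord] at hv
  have hnotin : j ∉ Finset.univ.filter (fun i => i < j) := by simp
  have h1 : (∑ i ∈ insert j (Finset.univ.filter (fun i => i < j)), n i)
      ≤ ∑ i ∈ Finset.univ.filter (fun i => i < j'), n i := by
    apply Finset.sum_le_sum_of_subset
    intro i hi
    simp only [Finset.mem_insert, Finset.mem_filter, Finset.mem_univ, true_and] at hi ⊢
    rcases hi with rfl | hi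
    · exact hlt
    · exact hi.trans hlt
  rw [Finset.sum_insert hnotin] at h1
  have := b.isLt
  omega

theorem blockCoord_bijective {N r : ℕ} {n : Fin r → ℕ} (hN : ∑ j, n j = N) :
    Function.Bijective (fun p : (Σ j : Fin r, Fin (n j)) => blockCoord hN p.1 p.2) := by
  rw [Fintype.bijective_iff_injective_and_card]
  constructor
  · rintro ⟨j, b⟩ ⟨j', b'⟩ h
    rcases lt_trichotomy j j' with hlt | rfl | hlt
    · exact absurd h (blockCoord_ne_of_lt hN hlt b b')
    · have hv := congrArg Fin.val h
      simp only [blockCoord] at hv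
      have : b = b' := by ext; omega
      rw [this]
    · exact absurd h.symm (blockCoord_ne_of_lt hN hlt b' b)
  · simp [hN]

/-- The `j`-th block of a word. -/
def blockOf {N r : ℕ} {n : Fin r → ℕ} (hN : ∑ j, n j = N) (x : BW N) (j : Fin r) :
    Fin (n j) → ZMod 2 := fun b => x (blockCoord hN j b)

theorem blockOf_flip_same {N r : ℕ} {n : Fin r → ℕ} (hN : ∑ j, n j = N) (x : BW N) (j : Fin r)
    (b : Fin (n j)) :
    blockOf hN (flipBit x (blockCoord hN j b)) j = flipBit (blockOf hN x j) b := by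
  ext b'
  by_cases h : b' = b
  · subst h
    simp [blockOf, flipBit]
  · have hne : blockCoord hN j b' ≠ blockCoord hN j b := by
      intro he
      have := (blockCoord_bijective hN).1 (a₁ := ⟨j, b'⟩) (a₂ := ⟨j, b⟩) he
      simp at this
      exact h this
    simp [blockOf, flipBit, h, hne]

theorem blockOf_flip_other {N r : ℕ} {n : Fin r → ℕ} (hN : ∑ j, n j = N) (x : BW N)
    (j j' : Fin r) (hj : j' ≠ j) (b : Fin (n j)) :
    blockOf hN (flipBit x (blockCoord hN j b)) j' = blockOf hN x j' := by
  ext b'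
  have hne : blockCoord hN j' b' ≠ blockCoord hN j b := by
    intro he
    have := (blockCoord_bijective hN).1 (a₁ := ⟨j', b'⟩) (a₂ := ⟨j, b⟩) he
    exact hj (congrArg Sigma.fst this)
  simp [blockOf, flipBit, hne]

theorem exists_of_blocks {N r : ℕ} {n : Fin r → ℕ} (hN : ∑ j, n j = N)
    (y : ∀ j, Fin (n j) → ZMod 2) : ∃ x : BW N, ∀ j, blockOf hN x j = y j := by
  let e := Equiv.ofBijective _ (blockCoord_bijective hN)
  refine ⟨fun k => y (e.symm k).1 (e.symm k).2, fun j => ?_⟩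
  ext b
  have : e.symm (blockCoord hN j b) = ⟨j, b⟩ := by
    rw [Equiv.symm_apply_eq]; rfl
  simp only [blockOf]
  rw [this]

theorem stmt_16 (r : ℕ) (hr : 1 ≤ r) (n : Fin r → ℕ)
    (hpos : ∀ j, 0 < n j) (h3 : ∀ j, 3 ∣ n j)
    (N : ℕ) (hN : ∑ j, n j = N)
    (T : ∀ j : Fin r, Fin 4 → Set (Fin (n j) → ZMod 2))
    (hT : ∀ j, IsEquitablePartition hAdj (T j) (fun a b => if a = b then 0 else n j / 3))
    (Cs : Fin 4 → Set (Fin r → Fin 4)) (hCs : IsLatinCube r Cs) :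
    IsEquitablePartition hAdj (fun i => concatProd hN T (Cs i))
      (fun a b => if a = b then 0 else N / 3) := by
  classical
  have hTne := fun j => (hT j).1
  have hTu := fun j => (hT j).2.1
  have hTc := fun j => (hT j).2.2
  obtain ⟨hCne, hCu, hCc⟩ := hCs
  choose t ht htu using hTu
  choose c hc hcu using hCu
  have htmem : ∀ j y a, y ∈ T j a ↔ t j y = a := fun j y a =>
    ⟨fun h => (htu j y a h).symm, fun h => h ▸ ht j y⟩
  have hcmem : ∀ v a, v ∈ Cs a ↔ c v = a := fun v a =>
    ⟨fun h => (hcu v a h).symm, fun h => h ▸ hc v⟩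
  have hmem : ∀ x a, x ∈ concatProd hN T (Cs a) ↔ c (fun j => t j (blockOf hN x j)) = a := by
    intro x a
    constructor
    · rintro ⟨v, hv, h⟩
      have : (fun j => t j (blockOf hN x j)) = v := by
        ext1 j
        exact (htmem _ _ _).1 (h j)
      rw [this]
      exact (hcmem _ _).1 hv
    · intro h
      exact ⟨_, (hcmem _ _).2 h, fun j => ht j _⟩
  -- adjacent words of the Hamming graph have different colours
  have hcadj : ∀ v w, hAdj v w → c v ≠ c w := by
    intro v w hvw he
    have h0 := hCc (c v) (c v) v (hc v)
    simp only [if_true] at h0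
    rw [Set.ncard_eq_zero (Set.toFinite _)] at h0
    have : w ∈ ({w | w ∈ Cs (c v) ∧ hAdj v w} : Set _) := ⟨by rw [he]; exact hc w, hvw⟩
    rw [h0] at this
    exact this
  -- each line of the Latin cube carries every colour exactly once
  have hline : ∀ (v : Fin r → Fin 4) (j : Fin r),
      Function.Bijective (fun a => c (Function.update v j a)) := by
    intro v j
    rw [← Finite.injective_iff_bijective]
    intro a a' h
    by_contra hne
    refine hcadj _ _ ?_ h
    rw [hAdj_iff_differ_once]
    exact ⟨j, by simpa using hne, fun i hi => by simp [hi]⟩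
  refine ⟨?_, ?_, ?_⟩
  · intro i
    obtain ⟨v, hv⟩ := hCne i
    choose y hy using fun j => hTne j (v j)
    obtain ⟨x, hx⟩ := exists_of_blocks hN y
    refine ⟨x, v, hv, fun j => ?_⟩
    have := hy j
    rw [← hx j] at this
    exact this
  · intro x
    exact ⟨_, (hmem x _).2 rfl, fun a ha => ((hmem x a).1 ha).symm⟩
  · intro i i' x hx
    have hx' := (hmem x i).1 hx
    set v : Fin r → Fin 4 := fun j => t j (blockOf hN x j) with hv
    have hflip : ∀ j b, (fun j' => t j' (blockOf hN (flipBit x (blockCoord hN j b)) j'))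
        = Function.update v j (t j (flipBit (blockOf hN x j) b)) := by
      intro j b
      ext1 j'
      by_cases h : j' = j
      · subst h
        rw [blockOf_flip_same]
        simp
      · rw [blockOf_flip_other hN x j j' h]
        simp [h, hv]
    rw [ncard_neighbors]
    have hcount : (Finset.univ.filter
          (fun k => flipBit x k ∈ concatProd hN T (Cs i'))).card
        = ∑ j, (Finset.univ.filter (fun b : Fin (n j) =>
            flipBit x (blockCoord hN j b) ∈ concatProd hN T (Cs i'))).card := by
      simp only [Finset.card_filter]
      rw [← (blockCoord_bijective hN).sum_comp
        (fun k => if flipBit x k ∈ concatProd hN T (Cs i') then 1 else 0)]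
      rw [Fintype.sum_sigma]
    have hblock : ∀ j, (Finset.univ.filter (fun b : Fin (n j) =>
            flipBit x (blockCoord hN j b) ∈ concatProd hN T (Cs i'))).card
          = if i = i' then 0 else n j / 3 := by
      intro j
      obtain ⟨a, ha⟩ := (hline v j).2 i'
      simp only at ha
      have h1 := hTc j (v j) a (blockOf hN x j) (ht j _)
      rw [ncard_neighbors] at h1
      have hiff : v j = a ↔ i = i' := by
        constructor
        · rintro rfl
          rw [← hx', ← ha, Function.update_eq_self]
        · intro h
          apply (hline v j).1
          simp only [Function.update_eq_self]
          rw [ha, hx', h]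
      simp only [hiff] at h1
      rw [← h1]
      congr 1
      ext b
      simp only [Finset.mem_filter, Finset.mem_univ, true_and]
      rw [hmem, hflip, htmem, ← ha]
      exact (hline v j).1.eq_iff
    rw [hcount, Finset.sum_congr rfl (fun j _ => hblock j)]
    by_cases h : i = i'
    · simp [h]
    · simp only [h, if_false]
      have h5 : N = 3 * ∑ j, n j / 3 := by
        rw [← hN, Finset.mul_sum]
        exact Finset.sum_congr rfl fun j _ => (Nat.mul_div_cancel' (h3 j)).symm
      omega
end

section
/- Let (C_i)_{i=0}^{k} be an equitable partition of the Hamming graph H(r,4) whose quotient matrix is one of: [[0,3r],[r,2r]] (k=1), [[0,r,2r],[r,0,2r],[r,r,r]] (k=2), or the 4×4 matrix with 0 on the diagonal and r in every off-diagonal entry (k=3). Then every cell C_i intersects every maximal clique of H(r,4) — i.e., every set of four words that agree in all coordinates except one fixed coordinate, in which they take all four values — in exactly |C_i|/4^{r−1} vertices. -/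
def Ln {r : ℕ} (C : Set (Fin r → Fin 4)) (p : Fin r) (w : Fin r → Fin 4) : Set (Fin r → Fin 4) :=
  {y | y ∈ C ∧ ∀ q : Fin r, q ≠ p → y q = w q}

lemma hAdj_iff_s17 {r : ℕ} (x y : Fin r → Fin 4) :
    hAdj x y ↔ ∃ p, x p ≠ y p ∧ ∀ q, q ≠ p → x q = y q := by
  unfold hAdj hammingDist
  rw [Finset.card_eq_one]
  constructor
  · rintro ⟨p, hp⟩
    have h : ∀ q, x q ≠ y q ↔ q = p := fun q => by
      have := congrArg (fun s => q ∈ s) hp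
      simpa using this
    exact ⟨p, (h p).2 rfl, fun q hq => by
      by_contra hc
      exact hq ((h q).1 hc)⟩
  · rintro ⟨p, hp, hq⟩
    refine ⟨p, ?_⟩
    ext q
    simp only [Finset.mem_filter, Finset.mem_univ, true_and, Finset.mem_singleton]
    constructor
    · intro h
      by_contra hc
      exact h (hq q hc)
    · rintro rfl
      exact hp

lemma Ln_le_one {r : ℕ} (C : Set (Fin r → Fin 4))
    (h0 : ∀ v ∈ C, ∀ w ∈ C, ¬ hAdj v w) (p : Fin r) (w : Fin r → Fin 4) :
    (Ln C p w).ncard ≤ 1 := by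
  rw [Set.ncard_le_one (Set.toFinite _)]
  rintro a ⟨ha, ha'⟩ b ⟨hb, hb'⟩
  by_contra hne
  apply h0 a ha b hb
  rw [hAdj_iff_s17]
  have hq : ∀ q, q ≠ p → a q = b q := fun q hq => (ha' q hq).trans (hb' q hq).symm
  refine ⟨p, fun hp => hne ?_, hq⟩
  funext q
  by_cases h : q = p
  · rw [h, hp]
  · exact hq q h

lemma Ln_eq_one_of_not_mem {r : ℕ} (C : Set (Fin r → Fin 4))
    (h0 : ∀ v ∈ C, ∀ w ∈ C, ¬ hAdj v w) (v : Fin r → Fin 4)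
    (h1 : {w | w ∈ C ∧ hAdj v w}.ncard = r) (p : Fin r) :
    (Ln C p v).ncard = 1 := by
  have hsub : {w | w ∈ C ∧ hAdj v w} ⊆ ⋃ p, Ln C p v := by
    rintro w ⟨hw, ha⟩
    rw [hAdj_iff_s17] at ha
    obtain ⟨p, -, hq⟩ := ha
    exact Set.mem_iUnion.2 ⟨p, hw, fun q h => (hq q h).symm⟩
  have h2 : r ≤ ∑ p, (Ln C p v).ncard := by
    calc r = _ := h1.symm
      _ ≤ _ := Set.ncard_le_ncard hsub (Set.toFinite _)
      _ ≤ _ := Set.ncard_iUnion_le_of_fintype _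
  by_contra hne
  have hlt : ∑ p, (Ln C p v).ncard < ∑ _p : Fin r, 1 :=
    Finset.sum_lt_sum (fun i _ => Ln_le_one C h0 i v)
      ⟨p, Finset.mem_univ _, lt_of_le_of_ne (Ln_le_one C h0 p v) hne⟩
  simp at hlt
  omega

lemma Ln_congr {r : ℕ} (C : Set (Fin r → Fin 4)) (p : Fin r) (v w : Fin r → Fin 4)
    (h : ∀ q, q ≠ p → v q = w q) : Ln C p v = Ln C p w := by
  ext y
  exact and_congr_right fun _ => forall_congr' fun q => forall_congr' fun hq => by rw [h q hq]

lemma Ln_eq_one {r : ℕ} (C : Set (Fin r → Fin 4))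
    (h0 : ∀ v ∈ C, {w | w ∈ C ∧ hAdj v w}.ncard = 0)
    (h1 : ∀ v, v ∉ C → {w | w ∈ C ∧ hAdj v w}.ncard = r) (p : Fin r) (w : Fin r → Fin 4) :
    (Ln C p w).ncard = 1 := by
  have h0' : ∀ v ∈ C, ∀ w ∈ C, ¬ hAdj v w := by
    intro v hv w hw ha
    have := h0 v hv
    rw [Set.ncard_eq_zero (Set.toFinite _)] at this
    exact (Set.eq_empty_iff_forall_notMem.1 this w) ⟨hw, ha⟩
  by_cases hw : w ∈ C
  · have hq : ∀ q, q ≠ p → w q = Function.update w p (w p + 1) q := by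
      intro q hq
      rw [Function.update_of_ne hq]
    have hn : Function.update w p (w p + 1) ∉ C := by
      intro hc
      refine h0' w hw _ hc ((hAdj_iff_s17 _ _).2 ⟨p, ?_, hq⟩)
      rw [Function.update_self]
      generalize w p = a
      revert a
      decide
    rw [Ln_congr C p _ _ hq]
    exact Ln_eq_one_of_not_mem C h0' _ (h1 _ hn) p
  · exact Ln_eq_one_of_not_mem C h0' w (h1 w hw) p

lemma Ln_univ {r : ℕ} (p : Fin r) (w : Fin r → Fin 4) :
    (Ln Set.univ p w).ncard = 4 := by
  have : Ln Set.univ p w = Set.range (fun a : Fin 4 => Function.update w p a) := by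
    ext y
    constructor
    · rintro ⟨-, h⟩
      refine ⟨y p, ?_⟩
      funext q
      by_cases hq : q = p
      · subst hq; simp
      · simp [Function.update_of_ne hq, h q hq]
    · rintro ⟨a, rfl⟩
      exact ⟨trivial, fun q hq => by simp [Function.update_of_ne hq]⟩
  rw [this, ← Set.image_univ, Set.ncard_image_of_injective _ (Function.update_injective w p)]
  simp

lemma Ln_union {r : ℕ} (A B : Set (Fin r → Fin 4)) (hd : Disjoint A B)
    (p : Fin r) (w : Fin r → Fin 4) :
    (Ln (A ∪ B) p w).ncard = (Ln A p w).ncard + (Ln B p w).ncard := by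
  rw [← Set.ncard_union_eq (hd.mono (fun _ h => h.1) (fun _ h => h.1))
    (Set.toFinite _) (Set.toFinite _)]
  congr 1
  ext y
  simp only [Ln, Set.mem_union, Set.mem_setOf_eq]
  tauto

lemma count {r : ℕ} (hr : 1 ≤ r) (C : Set (Fin r → Fin 4)) (m : ℕ)
    (h : ∀ p w, (Ln C p w).ncard = m) (p : Fin r) (w : Fin r → Fin 4) :
    4 ^ (r - 1) * {y | y ∈ C ∧ ∀ q : Fin r, q ≠ p → y q = w q}.ncard = C.ncard := by
  classical
  change 4 ^ (r - 1) * (Ln C p w).ncard = _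
  rw [h]
  have key : ∑ v : Fin r → Fin 4, (Ln C p v).ncard = ∑ y ∈ C.toFinset, (Ln Set.univ p y).ncard := by
    have e1 : ∀ v, (Ln C p v).ncard
        = (C.toFinset.filter (fun y => ∀ q : Fin r, q ≠ p → y q = v q)).card := by
      intro v
      rw [← Set.ncard_coe_finset]
      congr 1
      ext y
      simp [Ln]
    have e2 : ∀ y, (Ln Set.univ p y).ncard
        = (Finset.univ.filter (fun v : Fin r → Fin 4 => ∀ q : Fin r, q ≠ p → y q = v q)).card := by
      intro y
      rw [← Set.ncard_coe_finset]
      congr 1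
      ext v
      simp [Ln, eq_comm]
    simp only [e1, e2, Finset.card_filter]
    exact Finset.sum_comm
  simp only [h, Ln_univ, Finset.sum_const, smul_eq_mul, Finset.card_univ, Fintype.card_fun,
    Fintype.card_fin, ← Set.ncard_eq_toFinset_card'] at key
  obtain ⟨s, rfl⟩ : ∃ s, r = s + 1 := ⟨r - 1, by omega⟩
  simp only [Nat.add_sub_cancel]
  rw [pow_succ] at key
  linarith

lemma good {r k : ℕ} (Cs : Fin k → Set (Fin r → Fin 4)) (S : Fin k → Fin k → ℕ)
    (h : IsEquitablePartition hAdj Cs S) (i : Fin k) (h0 : S i i = 0)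
    (h1 : ∀ j, j ≠ i → S j i = r) (p : Fin r) (w : Fin r → Fin 4) :
    (Ln (Cs i) p w).ncard = 1 := by
  obtain ⟨-, hu, hS⟩ := h
  refine Ln_eq_one _ (fun v hv => (hS i i v hv).trans h0) (fun v hv => ?_) p w
  obtain ⟨j, hj, -⟩ := hu v
  have hji : j ≠ i := by
    rintro rfl
    exact hv hj
  exact (hS j i v hj).trans (h1 j hji)

lemma disj {r k : ℕ} (Cs : Fin k → Set (Fin r → Fin 4)) (S : Fin k → Fin k → ℕ)
    (h : IsEquitablePartition hAdj Cs S) (i j : Fin k) (hij : i ≠ j) :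
    Disjoint (Cs i) (Cs j) := by
  rw [Set.disjoint_left]
  intro v hi hj
  exact hij ((h.2.1 v).unique hi hj)

theorem stmt_17 (r : ℕ) (hr : 1 ≤ r) :
    (∀ Cs : Fin 2 → Set (Fin r → Fin 4),
      IsEquitablePartition hAdj Cs ![![0, 3*r], ![r, 2*r]] →
      ∀ (i : Fin 2) (p : Fin r) (w : Fin r → Fin 4),
        4 ^ (r - 1) * {y | y ∈ Cs i ∧ ∀ q : Fin r, q ≠ p → y q = w q}.ncard = (Cs i).ncard) ∧
    (∀ Cs : Fin 3 → Set (Fin r → Fin 4),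
      IsEquitablePartition hAdj Cs ![![0, r, 2*r], ![r, 0, 2*r], ![r, r, r]] →
      ∀ (i : Fin 3) (p : Fin r) (w : Fin r → Fin 4),
        4 ^ (r - 1) * {y | y ∈ Cs i ∧ ∀ q : Fin r, q ≠ p → y q = w q}.ncard = (Cs i).ncard) ∧
    (∀ Cs : Fin 4 → Set (Fin r → Fin 4),
      IsEquitablePartition hAdj Cs (fun i j => if i = j then 0 else r) →
      ∀ (i : Fin 4) (p : Fin r) (w : Fin r → Fin 4),
        4 ^ (r - 1) * {y | y ∈ Cs i ∧ ∀ q : Fin r, q ≠ p → y q = w q}.ncard = (Cs i).ncard) := by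
  refine ⟨?_, ?_, ?_⟩
  · intro Cs h i
    have g0 := good Cs _ h 0 rfl (by intro j hj; fin_cases j <;> simp_all)
    fin_cases i
    · exact count hr _ 1 g0
    · refine count hr _ 3 fun p w => ?_
      have hU : Cs 0 ∪ Cs 1 = Set.univ := by
        ext v
        obtain ⟨j, hj, -⟩ := h.2.1 v
        fin_cases j <;> simp_all
      have := Ln_union _ _ (disj Cs _ h 0 1 (by decide)) p w
      rw [hU, Ln_univ, g0] at this
      change (Ln (Cs 1) p w).ncard = 3
      omega
  · intro Cs h i
    have g0 := good Cs _ h 0 rfl (by intro j hj; fin_cases j <;> simp_all)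
    have g1 := good Cs _ h 1 rfl (by intro j hj; fin_cases j <;> simp_all)
    fin_cases i
    · exact count hr _ 1 g0
    · exact count hr _ 1 g1
    · refine count hr _ 2 fun p w => ?_
      have hU : Cs 0 ∪ Cs 1 ∪ Cs 2 = Set.univ := by
        ext v
        obtain ⟨j, hj, -⟩ := h.2.1 v
        fin_cases j <;> simp_all
      have h01 := Ln_union _ _ (disj Cs _ h 0 1 (by decide)) p w
      have := Ln_union (Cs 0 ∪ Cs 1) (Cs 2) (Set.disjoint_union_left.2
        ⟨disj Cs _ h 0 2 (by decide), disj Cs _ h 1 2 (by decide)⟩) p w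
      rw [hU, Ln_univ, h01, g0, g1] at this
      change (Ln (Cs 2) p w).ncard = 2
      omega
  · intro Cs h i
    exact count hr _ 1 (good Cs _ h i (by simp) (fun j hj => by simp [hj]))
end

section
/- Let t ≥ 1, m = 2t − 1, and let C ⊆ F_2^m be a t-fold 1-perfect code, i.e., every radius-1 ball in Q_m contains exactly t elements of C. Let C' = {(c, wt(c) mod 2) : c ∈ C} ⊆ F_2^{m+1} be the extended code, and let E and O denote the sets of even-weight and odd-weight words of F_2^{m+1}, respectively. Then (C', E \ C', O) is an equitable partition of Q_{m+1} with quotient matrix [[0, 0, 2t], [0, 0, 2t], [t, t, 0]]. -/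
/-- `C` is a `t`-fold 1-perfect code in `Q_m`: every radius-1 ball contains
exactly `t` elements of `C`. -/
def IsMultifoldPerfect {m : ℕ} (t : ℕ) (C : Set (BW m)) : Prop :=
  ∀ x : BW m, {c | c ∈ C ∧ hammingDist x c ≤ 1}.ncard = t

lemma dist_cast {n : ℕ} (x y : BW n) :
    ((hammingDist x y : ℕ) : ZMod 2) = (hammingNorm x : ZMod 2) + (hammingNorm y : ZMod 2) := by
  rw [hammingDist_eq_hammingNorm, norm_cast_sum, norm_cast_sum, norm_cast_sum,
    ← Finset.sum_add_distrib]
  refine Finset.sum_congr rfl fun i _ => ?_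
  have h2 : ∀ a b : ZMod 2, a - b = a + b := by decide
  simp [h2, CharTwo.neg_eq]

lemma even_dist {n : ℕ} (x y : BW n) :
    Even (hammingDist x y) ↔ (Even (hammingNorm x) ↔ Even (hammingNorm y)) := by
  rw [← Nat.even_add, ← ZMod.natCast_eq_zero_iff_even, dist_cast, ← Nat.cast_add,
    ZMod.natCast_eq_zero_iff_even]

lemma dist_snoc {n : ℕ} (v : BW (n + 1)) (c : BW n) (p : ZMod 2) :
    hammingDist v (Fin.snoc c p : BW (n + 1)) =
      hammingDist (Fin.init v : BW n) c + if v (Fin.last n) ≠ p then 1 else 0 := by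
  unfold hammingDist
  rw [Finset.card_filter, Finset.card_filter, Fin.sum_univ_castSucc]
  simp only [Fin.snoc_castSucc, Fin.snoc_last, Fin.init]
  congr!

lemma even_snoc {n : ℕ} (c : BW n) :
    Even (hammingNorm (Fin.snoc c (hammingNorm c : ZMod 2) : BW (n + 1))) := by
  rw [← ZMod.natCast_eq_zero_iff_even, norm_cast_sum, Fin.sum_univ_castSucc]
  simp only [Fin.snoc_castSucc, Fin.snoc_last]
  rw [norm_cast_sum]
  exact CharTwo.add_self_eq_zero _

lemma sphere_ncard {n : ℕ} (v : BW n) : {w : BW n | hammingDist v w = 1}.ncard = n := by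
  have hinj : Function.Injective (fun i : Fin n => v + Pi.single i (1 : ZMod 2)) := by
    intro i j h
    have h' := congrFun (add_left_cancel h) i
    by_contra hne
    simp [Pi.single_apply, hne] at h'
  have hr : {w : BW n | hammingDist v w = 1} =
      Set.range (fun i : Fin n => v + Pi.single i (1 : ZMod 2)) := by
    ext w
    simp only [Set.mem_setOf_eq, Set.mem_range]
    constructor
    · intro h
      obtain ⟨i, hi⟩ := Finset.card_eq_one.mp h
      refine ⟨i, funext fun j => ?_⟩
      have hj : v j ≠ w j ↔ j = i := by
        have := Finset.ext_iff.mp hi j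
        simpa using this
      have h2 : ∀ a b : ZMod 2, a ≠ b → a + 1 = b := by decide
      by_cases hji : j = i
      · subst hji
        simpa using h2 _ _ (hj.mpr rfl)
      · have : v j = w j := by
          by_contra hne
          exact hji (hj.mp hne)
        simp [Pi.single_apply, hji, this]
    · rintro ⟨i, rfl⟩
      refine Finset.card_eq_one.mpr ⟨i, ?_⟩
      ext j
      simp [Pi.single_apply]
  rw [hr, ← Set.image_univ, Set.ncard_image_of_injective _ hinj, Set.ncard_univ]
  simp

theorem stmt_19 (t m : ℕ) (ht : 1 ≤ t) (hm : m = 2 * t - 1)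
    (C : Set (BW m)) (hC : IsMultifoldPerfect t C)
    (C' : Set (BW (m + 1)))
    (hC' : C' = {z | ∃ c ∈ C, z = Fin.snoc c ((hammingNorm c : ZMod 2))}) :
    IsEquitablePartition hAdj
      ![C', {z : BW (m + 1) | Even (hammingNorm z)} \ C',
        {z : BW (m + 1) | Odd (hammingNorm z)}]
      ![![0, 0, 2*t], ![0, 0, 2*t], ![t, t, 0]] := by
  have hm1 : m + 1 = 2 * t := by omega
  have hCe : ∀ z ∈ C', Even (hammingNorm z) := by
    subst hC'
    rintro z ⟨c, _, rfl⟩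
    exact even_snoc c
  have hadj : ∀ v w : BW (m + 1), hammingDist v w = 1 →
      (Even (hammingNorm v) ↔ Odd (hammingNorm w)) := by
    intro v w h
    have := even_dist v w
    rw [h] at this
    rw [← Nat.not_even_iff_odd]
    have h1 : ¬ Even 1 := by decide
    tauto
  have hsph : ∀ v : BW (m + 1), {w : BW (m + 1) | hammingDist v w = 1}.ncard = 2 * t := by
    intro v
    rw [sphere_ncard, hm1]
  have hcode : ∀ v : BW (m + 1), Odd (hammingNorm v) →
      {w | w ∈ C' ∧ hammingDist v w = 1}.ncard = t := by
    intro v hv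
    rw [← hC (Fin.init v : BW m)]
    have hinj : Function.Injective
        (fun c : BW m => (Fin.snoc c (hammingNorm c : ZMod 2) : BW (m + 1))) := by
      intro a b h
      have := congrArg (fun z : BW (m + 1) => (Fin.init z : BW m)) h
      simpa using this
    rw [← Set.ncard_image_of_injective _ hinj]
    congr 1
    have key : ∀ c : BW m, hammingDist v (Fin.snoc c (hammingNorm c : ZMod 2) : BW (m + 1)) = 1 ↔
        hammingDist (Fin.init v : BW m) c ≤ 1 := by
      intro c
      have h1 := even_dist v (Fin.snoc c (hammingNorm c : ZMod 2) : BW (m + 1))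
      have h2 := even_snoc c
      have h3 : ¬ Even (hammingNorm v) := Nat.not_even_iff_odd.mpr hv
      have h4 : Odd (hammingDist v (Fin.snoc c (hammingNorm c : ZMod 2) : BW (m + 1))) := by
        rw [← Nat.not_even_iff_odd]
        tauto
      rw [dist_snoc] at h4 ⊢
      obtain ⟨k, hk⟩ := h4
      split_ifs at hk ⊢ <;> omega
    ext w
    subst hC'
    constructor
    · rintro ⟨⟨c, hc, rfl⟩, hd⟩
      exact ⟨c, ⟨hc, (key c).mp hd⟩, rfl⟩
    · rintro ⟨c, ⟨hc, hd⟩, rfl⟩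
      exact ⟨⟨c, hc, rfl⟩, (key c).mpr hd⟩
  have hnon : ∀ v : BW (m + 1), Odd (hammingNorm v) →
      {w | w ∈ {z : BW (m + 1) | Even (hammingNorm z)} \ C' ∧ hammingDist v w = 1}.ncard = t := by
    intro v hv
    have h1 := Set.ncard_sdiff_add_ncard_of_subset
      (s := {w | w ∈ C' ∧ hammingDist v w = 1}) (t := {w : BW (m + 1) | hammingDist v w = 1})
      (fun w hw => hw.2) (Set.toFinite _)
    rw [hsph, hcode v hv] at h1
    have h2 : {w | w ∈ {z : BW (m + 1) | Even (hammingNorm z)} \ C' ∧ hammingDist v w = 1} =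
        {w : BW (m + 1) | hammingDist v w = 1} \ {w | w ∈ C' ∧ hammingDist v w = 1} := by
      ext w
      simp only [Set.mem_setOf_eq, Set.mem_diff]
      constructor
      · tauto
      · rintro ⟨hd, hn⟩
        refine ⟨⟨?_, fun h => hn ⟨h, hd⟩⟩, hd⟩
        rw [hammingDist_comm] at hd
        by_contra hne
        have := hadj w v hd
        tauto
    rw [h2]
    omega
  have heo : ∀ v : BW (m + 1), Even (hammingNorm v) →
      {w | w ∈ {z : BW (m + 1) | Odd (hammingNorm z)} ∧ hammingDist v w = 1}.ncard = 2 * t := by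
    intro v hv
    rw [← hsph v]
    congr 1
    ext w
    simp only [Set.mem_setOf_eq]
    exact ⟨fun h => h.2, fun h => ⟨(hadj v w h).mp hv, h⟩⟩
  have hemp : ∀ (v : BW (m + 1)) (D : Set (BW (m + 1))),
      (∀ w ∈ D, (Even (hammingNorm v) ↔ Even (hammingNorm w))) →
      {w | w ∈ D ∧ hammingDist v w = 1}.ncard = 0 := by
    intro v D hD
    rw [Set.ncard_eq_zero]
    ext w
    simp only [Set.mem_setOf_eq, Set.mem_empty_iff_false, iff_false]
    rintro ⟨hw, hd⟩
    have h1 := hD w hw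
    have h2 := hadj v w hd
    rw [← Nat.not_even_iff_odd] at h2
    tauto
  have hoddne : ∃ v : BW (m + 1), Odd (hammingNorm v) := by
    have h : {w | w ∈ {z : BW (m + 1) | Odd (hammingNorm z)} ∧ hammingDist 0 w = 1}.Nonempty := by
      apply Set.nonempty_of_ncard_ne_zero
      rw [heo 0 (by simp)]
      omega
    exact ⟨h.some, h.some_mem.1⟩
  obtain ⟨u, hu⟩ := hoddne
  refine ⟨?_, ?_, ?_⟩
  · intro i
    fin_cases i
    · have h := Set.nonempty_of_ncard_ne_zero (by rw [hcode u hu]; omega :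
        {w | w ∈ C' ∧ hammingDist u w = 1}.ncard ≠ 0)
      exact ⟨h.some, h.some_mem.1⟩
    · have h := Set.nonempty_of_ncard_ne_zero (by rw [hnon u hu]; omega :
        {w | w ∈ {z : BW (m + 1) | Even (hammingNorm z)} \ C' ∧ hammingDist u w = 1}.ncard ≠ 0)
      exact ⟨h.some, h.some_mem.1⟩
    · exact ⟨u, hu⟩
  · intro v
    by_cases hc : v ∈ C'
    · have he := hCe v hc
      refine ⟨0, hc, ?_⟩
      intro j hj
      fin_cases j
      · rfl
      · exact absurd hc hj.2
      · exact absurd he (Nat.not_even_iff_odd.mpr hj)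
    · by_cases he : Even (hammingNorm v)
      · refine ⟨1, ⟨he, hc⟩, ?_⟩
        intro j hj
        fin_cases j
        · exact absurd hj hc
        · rfl
        · exact absurd he (Nat.not_even_iff_odd.mpr hj)
      · refine ⟨2, Nat.not_even_iff_odd.mp he, ?_⟩
        intro j hj
        fin_cases j
        · exact absurd hj hc
        · exact absurd hj.1 he
        · rfl
  · intro i j v hv
    fin_cases i <;> fin_cases j
    · exact hemp v C' fun w hw => iff_of_true (hCe v hv) (hCe w hw)
    · exact hemp v _ fun w hw => iff_of_true (hCe v hv) hw.1
    · exact heo v (hCe v hv)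
    · exact hemp v C' fun w hw => iff_of_true hv.1 (hCe w hw)
    · exact hemp v _ fun w hw => iff_of_true hv.1 hw.1
    · exact heo v hv.1
    · exact hcode v hv
    · exact hnon v hv
    · exact hemp v _ fun w hw => iff_of_false (Nat.not_even_iff_odd.mpr hv)
        (Nat.not_even_iff_odd.mpr hw)
end
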